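/- For all a, b, e, f ∈ A such that ê = ((S(a*))^)* · b̂ and f̂ = b̂ · â (convolution products of linear functionals on A, with ω*(x) = conj(ω(S(x)*))), one has ε(e) = ε(f). Equivalently ψ̂(((S(a*))^)* · b̂) = ψ̂(b̂ · â) for all b ∈ A, which expresses the identity ρ̂(((S(a*))^)*) = â for the modular automorphism ρ̂ of the dual determined by ψ̂(ω η) = ψ̂(η ρ̂(ω)). (Lemma 2.2(2).) -/

import Mathlib

open scoped TensorProduct ComplexOrder

noncomputable section

/-- Right slice map `(id ⊗ φ) : M ⊗ A → M`. -/
def rslice {A M : Type*} [AddCommGroup A] [Module ℂ A] [AddCommGroup M] [Module ℂ M]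
    (φ : A →ₗ[ℂ] ℂ) : M ⊗[ℂ] A →ₗ[ℂ] M :=
  (TensorProduct.rid ℂ M).toLinearMap ∘ₗ TensorProduct.map LinearMap.id φ

/-- Left slice map `(φ ⊗ id) : A ⊗ M → M`. -/
def lslice {A M : Type*} [AddCommGroup A] [Module ℂ A] [AddCommGroup M] [Module ℂ M]
    (φ : A →ₗ[ℂ] ℂ) : A ⊗[ℂ] M →ₗ[ℂ] M :=
  (TensorProduct.lid ℂ M).toLinearMap ∘ₗ TensorProduct.map φ LinearMap.id

/-- The pairing `(ω ⊗ η) : A ⊗ A → ℂ`. -/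
def pair {A : Type*} [AddCommGroup A] [Module ℂ A] (ω η : A →ₗ[ℂ] ℂ) :
    A ⊗[ℂ] A →ₗ[ℂ] ℂ :=
  LinearMap.mul' ℂ ℂ ∘ₗ TensorProduct.map ω η

/-- Convolution product of linear functionals: `ω₁·ω₂ = (ω₁ ⊗ ω₂) ∘ Δ`. -/
def conv {A : Type*} [Ring A] [Algebra ℂ A] (Δ : A →ₐ[ℂ] A ⊗[ℂ] A)
    (ω η : A →ₗ[ℂ] ℂ) : A →ₗ[ℂ] ℂ :=
  pair ω η ∘ₗ Δ.toLinearMap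

/-- The conjugate dual functional `x ↦ conj (ω (x*))`. -/
def conjdual {A : Type*} [Ring A] [Algebra ℂ A] [StarRing A] [StarModule ℂ A]
    (ω : A →ₗ[ℂ] ℂ) : A →ₗ[ℂ] ℂ where
  toFun x := starRingEnd ℂ (ω (star x))
  map_add' x y := by simp
  map_smul' c x := by simp [star_smul, smul_eq_mul, map_mul]

/-- A (unital) algebraic quantum group: a unital Hopf ∗-algebra over ℂ with a
positive faithful left Haar integral, together with the associated modular
data `ρ`, `δ`, `μ`. -/
structure AQG (A : Type*) [Ring A] [Algebra ℂ A] [StarRing A] [StarModule ℂ A] where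
  Δ : A →ₐ[ℂ] A ⊗[ℂ] A
  ε : A →ₐ[ℂ] ℂ
  S : A →ₗ[ℂ] A
  Sinv : A →ₗ[ℂ] A
  φ : A →ₗ[ℂ] ℂ
  ρ : A →ₗ[ℂ] A
  ρinv : A →ₗ[ℂ] A
  δ : A
  δinv : A
  μ : ℂ
  /-- `Δ` is a ∗-homomorphism (expressed by composing with functionals, since
  they separate points of `A ⊗ A`). -/
  Δ_star : ∀ (f g : A →ₗ[ℂ] ℂ) (a : A),
    pair f g (Δ (star a)) = starRingEnd ℂ (pair (conjdual f) (conjdual g) (Δ a))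
  ε_star : ∀ a, ε (star a) = starRingEnd ℂ (ε a)
  coassoc : ∀ a, TensorProduct.assoc ℂ A A A
      (TensorProduct.map Δ.toLinearMap LinearMap.id (Δ a)) =
      TensorProduct.map LinearMap.id Δ.toLinearMap (Δ a)
  counit_left : ∀ a, lslice ε.toLinearMap (Δ a) = a
  counit_right : ∀ a, rslice ε.toLinearMap (Δ a) = a
  S_leftinv : Function.LeftInverse Sinv S
  S_rightinv : Function.RightInverse Sinv S
  S_antimul : ∀ a b, S (a * b) = S b * S a
  S_one : S 1 = 1
  antipode_left : ∀ a, LinearMap.mul' ℂ A (TensorProduct.map S LinearMap.id (Δ a)) = ε a • 1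
  antipode_right : ∀ a, LinearMap.mul' ℂ A (TensorProduct.map LinearMap.id S (Δ a)) = ε a • 1
  S_star_S : ∀ a, S (star (S (star a))) = a
  /-- positivity of the Haar functional -/
  φ_pos : ∀ a, 0 ≤ φ (star a * a)
  φ_faithful : ∀ a, φ (star a * a) = 0 → a = 0
  /-- left invariance: `(id ⊗ φ)(Δ a) = φ(a)·1` -/
  φ_left_inv : ∀ a, rslice φ (Δ a) = φ a • (1 : A)
  /-- strong left invariance -/
  φ_strong : ∀ a b, rslice φ ((1 ⊗ₜ[ℂ] a) * Δ b) = S (rslice φ (Δ a * (1 ⊗ₜ[ℂ] b)))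
  ρ_mul : ∀ a b, ρ (a * b) = ρ a * ρ b
  ρ_leftinv : Function.LeftInverse ρinv ρ
  ρ_rightinv : Function.RightInverse ρinv ρ
  φ_ρ : ∀ a b, φ (a * b) = φ (b * ρ a)
  δ_star : star δ = δ
  δ_mul_δinv : δ * δinv = 1
  δinv_mul_δ : δinv * δ = 1
  Δ_δ : Δ δ = δ ⊗ₜ[ℂ] δ
  ε_δ : ε δ = 1
  S_δ : S δ = δinv
  μ_norm : ‖μ‖ = 1
  φ_S : ∀ a, φ (S a) = φ (a * δ)
  φ_δ : ∀ a, φ (a * δ) = μ * φ (δ * a)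

namespace AQG

variable {A : Type*} [Ring A] [Algebra ℂ A] [StarRing A] [StarModule ℂ A] (G : AQG A)

/-- `â : c ↦ φ(c a)`. -/
def hat (a : A) : A →ₗ[ℂ] ℂ := G.φ ∘ₗ LinearMap.mulRight ℂ a

/-- Involution on functionals: `ω*(x) = conj (ω (S(x)*))`. -/
def inv' (ω : A →ₗ[ℂ] ℂ) : A →ₗ[ℂ] ℂ := conjdual ω ∘ₗ G.S

end AQG


namespace AQG

variable {A : Type*} [Ring A] [Algebra ℂ A] [StarRing A] [StarModule ℂ A] (G : AQG A)

theorem φ_star (x : A) : G.φ (star x) = starRingEnd ℂ (G.φ x) := by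
  have him : ∀ y : A, (G.φ (star y * y)).im = 0 := fun y =>
    (Complex.nonneg_iff.mp (G.φ_pos y)).2.symm
  have h0 := him 1
  have h1 := him x
  have h2 := him (1 + x)
  have h3 := him (1 + Complex.I • x)
  simp only [star_add, star_one, star_smul, add_mul, mul_add, one_mul, mul_one, smul_mul_assoc,
    mul_smul_comm, map_add, map_smul, smul_eq_mul, Complex.add_im, Complex.mul_im, Complex.mul_re,
    Complex.star_def, Complex.conj_I, Complex.neg_re, Complex.neg_im, Complex.I_re,
    Complex.I_im] at h0 h1 h2 h3
  apply Complex.ext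
  · simp only [Complex.conj_re]; linarith
  · simp only [Complex.conj_im]; linarith

theorem hat_injective : Function.Injective G.hat := by
  intro a b h
  refine sub_eq_zero.mp (G.φ_faithful _ ?_)
  have := LinearMap.congr_fun h (star (a - b))
  simp only [hat, LinearMap.comp_apply, LinearMap.mulRight_apply] at this
  rw [mul_sub, map_sub, this, sub_self]

theorem Sinv_antimul (a b : A) : G.Sinv (a * b) = G.Sinv b * G.Sinv a := by
  apply G.S_leftinv.injective
  rw [G.S_antimul, G.S_rightinv, G.S_rightinv, G.S_rightinv]

theorem pair_hat (ω : A →ₗ[ℂ] ℂ) (b : A) (t : A ⊗[ℂ] A) :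
    pair ω (G.hat b) t = ω (rslice G.φ (t * (1 ⊗ₜ[ℂ] b))) := by
  induction t with
  | zero => simp
  | tmul x y => simp [pair, hat, rslice, mul_comm]
  | add x y hx hy => rw [add_mul, map_add, map_add, map_add, hx, hy]

theorem apply_rslice_one_tmul_mul (η : A →ₗ[ℂ] ℂ) (x : A) (t : A ⊗[ℂ] A) :
    η (rslice G.φ ((1 ⊗ₜ[ℂ] x) * t)) = G.φ (x * lslice η t) := by
  induction t with
  | zero => simp
  | tmul y z => simp [lslice, rslice, mul_comm]
  | add y z hy hz => rw [mul_add, map_add, map_add, map_add, mul_add, map_add, hy, hz]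

theorem counit_lslice (η : A →ₗ[ℂ] ℂ) (b : A) : G.ε (lslice η (G.Δ b)) = η b := by
  have key : ∀ t : A ⊗[ℂ] A, G.ε (lslice η t) = η (rslice G.ε.toLinearMap t) := by
    intro t
    induction t with
    | zero => simp
    | tmul y z => simp [lslice, rslice, mul_comm]
    | add y z hy hz => rw [map_add, map_add, map_add, map_add, hy, hz]
  rw [key, G.counit_right]

/-- The convolution `ω · b̂` is represented by `(ω ∘ S⁻¹ ⊗ id)(Δ b)`. -/
theorem conv_hat (ω : A →ₗ[ℂ] ℂ) (b : A) :
    conv G.Δ ω (G.hat b) = G.hat (lslice (ω ∘ₗ G.Sinv) (G.Δ b)) := by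
  ext x
  change pair ω (G.hat b) (G.Δ x) = G.φ (x * _)
  rw [pair_hat, ← apply_rslice_one_tmul_mul, G.φ_strong, LinearMap.comp_apply, G.S_leftinv]

theorem counit_of_hat_eq_conv {ω : A →ₗ[ℂ] ℂ} {b e : A}
    (h : G.hat e = conv G.Δ ω (G.hat b)) : G.ε e = ω (G.Sinv b) := by
  rw [G.conv_hat] at h
  rw [G.hat_injective h, G.counit_lslice, LinearMap.comp_apply]

theorem inv'_hat_S_star (a x : A) :
    G.inv' (G.hat (G.S (star a))) x = G.φ (G.Sinv a * G.S x) := by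
  change starRingEnd ℂ (G.φ (star (G.S x) * G.S (star a))) = _
  have h : star (G.S (star a)) = G.Sinv a := by
    apply G.S_leftinv.injective
    rw [G.S_star_S, G.S_rightinv]
  rw [← G.φ_star, star_mul, star_star, h]

end AQG

/-- Lemma 2.2(2): `ψ̂(((S(a*))^)* · b̂) = ψ̂(b̂ · â)`, i.e. `ρ̂(((S(a*))^)*) = â`. -/
theorem stmt5 {A : Type*} [Ring A] [Algebra ℂ A] [StarRing A] [StarModule ℂ A]
    (G : AQG A) :
    ∀ a b e f : A,
      G.hat e = conv G.Δ (G.inv' (G.hat (G.S (star a)))) (G.hat b) →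
      G.hat f = conv G.Δ (G.hat b) (G.hat a) →
      G.ε e = G.ε f := by
  intro a b e f he hf
  rw [G.counit_of_hat_eq_conv he, G.counit_of_hat_eq_conv hf, G.inv'_hat_S_star, G.S_rightinv]
  rfl
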